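/- arXiv:2601.01670 — 2 statements merged into one kernel-verified Lean document; each statement's English description precedes it below -/
import Mathlib

section
/- Under the stated hypotheses, |u(t)| ≤ (Σ_{j=0}^{K} (1+c)^j)·(a₀+a₁+a₂)·e^{bt} for all t∈[0,T]. -/
open Set Filter

/-- Integral Gronwall inequality for a monotone, not necessarily continuous, function. -/
theorem MonotoneOn.le_mul_exp_of_le_add_integral {m : ℝ → ℝ} {p d b C : ℝ} (hpd : p ≤ d)
    (hb : 0 ≤ b) (hm : MonotoneOn m (Icc p d))
    (h : ∀ x ∈ Icc p d, m x ≤ C + b * ∫ s in p..x, m s) :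
    ∀ x ∈ Icc p d, m x ≤ C * Real.exp (b * (x - p)) := by
  set f : ℝ → ℝ := fun x => m x * Real.exp (-(b * (x - p))) with hf
  have hm_eq : ∀ x, m x = f x * Real.exp (b * (x - p)) := fun x => by
    rw [hf, mul_assoc, ← Real.exp_add]; simp
  have hbdd : BddAbove (f '' Icc p d) := by
    refine ⟨|m d|, ?_⟩
    rintro _ ⟨x, hx, rfl⟩
    have h1 : m x ≤ |m d| := (hm hx ⟨hpd, le_rfl⟩ hx.2).trans (le_abs_self _)
    have h2 : Real.exp (-(b * (x - p))) ≤ 1 := by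
      have := mul_nonneg hb (sub_nonneg.2 hx.1)
      exact Real.exp_le_one_iff.2 (by linarith)
    calc m x * Real.exp (-(b * (x - p))) ≤ |m d| * Real.exp (-(b * (x - p))) := by gcongr
      _ ≤ |m d| * 1 := by gcongr
      _ = |m d| := mul_one _
  set D := sSup (f '' Icc p d) with hD
  have hfD : ∀ x ∈ Icc p d, f x ≤ D := fun x hx => le_csSup hbdd ⟨x, hx, rfl⟩
  have hint : ∀ x, b * ∫ s in p..x, D * Real.exp (b * (s - p)) =
      D * (Real.exp (b * (x - p)) - 1) := fun x => by
    have hd : ∀ s ∈ uIcc p x, HasDerivAt (fun s => D * Real.exp (b * (s - p)))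
        (b * (D * Real.exp (b * (s - p)))) s := fun s _ => by
      exact (((((hasDerivAt_id' s).sub_const p).const_mul b).exp).const_mul D).congr_deriv
        (by ring)
    rw [← intervalIntegral.integral_const_mul,
      intervalIntegral.integral_eq_sub_of_hasDerivAt hd
        (Continuous.intervalIntegrable (by fun_prop) _ _)]
    simp; ring
  have hstep : ∀ x ∈ Icc p d, f x ≤ D + (C - D) * Real.exp (-(b * (x - p))) := fun x hx => by
    have h1 : ∫ s in p..x, m s ≤ ∫ s in p..x, D * Real.exp (b * (s - p)) := by
      refine intervalIntegral.integral_mono_on hx.1 ?_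
        (Continuous.intervalIntegrable (by fun_prop) _ _) fun s hs => ?_
      · apply MonotoneOn.intervalIntegrable
        rw [uIcc_of_le hx.1]
        exact hm.mono (Icc_subset_Icc_right hx.2)
      · rw [hm_eq s]
        have := hfD s ⟨hs.1, hs.2.trans hx.2⟩
        gcongr
    have h2 : m x ≤ C + D * (Real.exp (b * (x - p)) - 1) := by
      rw [← hint x]
      exact (h x hx).trans (by gcongr)
    calc f x ≤ (C + D * (Real.exp (b * (x - p)) - 1)) * Real.exp (-(b * (x - p))) := by
          simp only [hf]; gcongr
      _ = D + (C - D) * Real.exp (-(b * (x - p))) := by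
          rw [Real.exp_neg]; field_simp; ring
  have hDC : D ≤ C := by
    by_contra! hlt
    have : D ≤ D + (C - D) * Real.exp (-(b * (d - p))) := by
      refine csSup_le ⟨_, p, ⟨le_rfl, hpd⟩, rfl⟩ ?_
      rintro _ ⟨x, hx, rfl⟩
      refine (hstep x hx).trans ?_
      have : Real.exp (-(b * (d - p))) ≤ Real.exp (-(b * (x - p))) := by
        have := hx.2
        gcongr
      nlinarith
    nlinarith [Real.exp_pos (-(b * (d - p)))]
  intro x hx
  rw [hm_eq x]
  have := (hfD x hx).trans hDC
  gcongr

/-- Delayed Gronwall inequality between two consecutive impulses. -/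
theorem norm_le_mul_exp_of_le_add_integral_sSup {E : Type*} [NormedAddCommGroup E] {u : ℝ → E}
    {a b C l p q : ℝ} (hlp : l ≤ p) (hb : 0 ≤ b)
    (hcont : ContinuousOn u (Ico p q)) (hpast : ∀ s ∈ Ico l p, ‖u s‖ ≤ C)
    (hp : ‖u p‖ + a ≤ C)
    (hineq : ∀ x ∈ Ico p q, ‖u x‖ ≤ ‖u p‖ + a +
      b * ∫ s in p..x, sSup ((fun ζ => ‖u ζ‖) '' Icc l s)) :
    ∀ x ∈ Ico p q, ‖u x‖ ≤ C * Real.exp (b * (x - p)) := by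
  intro d hd
  set m : ℝ → ℝ := fun s => sSup ((fun ζ => ‖u ζ‖) '' Icc l s) with hmdef
  have hbdd : ∀ x ≤ d, BddAbove ((fun ζ => ‖u ζ‖) '' Icc l x) := fun x hx => by
    have h1 : ContinuousOn (fun ζ => ‖u ζ‖) (Icc p d) :=
      (hcont.mono (Icc_subset_Ico_right hd.2)).norm
    obtain ⟨B, hB⟩ := (isCompact_Icc.image_of_continuousOn h1).bddAbove
    refine ⟨max B C, ?_⟩
    rintro _ ⟨ζ, hζ, rfl⟩
    rcases lt_or_ge ζ p with h | h
    · exact (hpast ζ ⟨hζ.1, h⟩).trans (le_max_right _ _)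
    · exact (hB ⟨ζ, ⟨h, hζ.2.trans hx⟩, rfl⟩).trans (le_max_left _ _)
  have hm0 : ∀ x, 0 ≤ m x := fun x => by
    apply Real.sSup_nonneg
    rintro _ ⟨ζ, -, rfl⟩
    exact norm_nonneg _
  have hmono : MonotoneOn m (Icc p d) := fun x hx y hy hxy =>
    csSup_le_csSup (hbdd y hy.2) ⟨_, l, ⟨le_rfl, hlp.trans hx.1⟩, rfl⟩
      (image_mono (Icc_subset_Icc_right hxy))
  have hm : ∀ x ∈ Icc p d, m x ≤ C + b * ∫ s in p..x, m s := fun x hx => by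
    have hint : IntervalIntegrable m MeasureTheory.volume p x := by
      apply MonotoneOn.intervalIntegrable
      rw [uIcc_of_le hx.1]
      exact hmono.mono (Icc_subset_Icc_right hx.2)
    refine csSup_le ⟨_, l, ⟨le_rfl, hlp.trans hx.1⟩, rfl⟩ ?_
    rintro _ ⟨ζ, hζ, rfl⟩
    rcases lt_or_ge ζ p with h | h
    · have := mul_nonneg hb (intervalIntegral.integral_nonneg
        (μ := MeasureTheory.volume) hx.1 fun s _ => hm0 s)
      linarith [hpast ζ ⟨hζ.1, h⟩]
    · have h1 : ∫ s in p..ζ, m s ≤ ∫ s in p..x, m s :=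
        intervalIntegral.integral_mono_interval le_rfl h hζ.2 (.of_forall hm0) hint
      have h2 := hineq ζ ⟨h, (hζ.2.trans hx.2).trans_lt hd.2⟩
      have h3 := mul_le_mul_of_nonneg_left h1 hb
      simp only [hmdef] at h3 ⊢
      linarith
  exact (le_csSup (hbdd d le_rfl) ⟨d, ⟨hlp.trans hd.1, le_rfl⟩, rfl⟩).trans
    (hmono.le_mul_exp_of_le_add_integral hd.1 hb hm d ⟨hd.1, le_rfl⟩)

/-- Lemma 2.3 (impulsive Gronwall-type inequality): if `u : [-r,T] → ℝⁿ` is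
piecewise continuous with possible jumps at the impulsive moments
`0 = t 0 < t 1 < ⋯ < t K < t (K+1) = T`, has finite left limits there,
satisfies `‖u‖ ≤ a₀` on `[-r,0]`, satisfies the delayed integral inequality
`‖u(t)‖ ≤ ‖u(t_k)‖ + a₁ + b ∫_{t_k}^t sup_{-r ≤ ζ ≤ s} ‖u(ζ)‖ ds` on each
`[t_k, t_{k+1})`, and the jumps satisfy `‖Δu(t_k)‖ ≤ c‖u(t_k-)‖ + a₂`, then
`‖u(t)‖ ≤ (Σ_{j=0}^K (1+c)^j)(a₀+a₁+a₂) e^{bt}` on `[0,T]`. -/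
theorem stmt1 (n K : ℕ) (a0 a1 a2 b c r T : ℝ)
    (ha0 : 0 ≤ a0) (ha1 : 0 ≤ a1) (ha2 : 0 ≤ a2) (hb : 0 ≤ b) (hc : 0 ≤ c)
    (hr : 0 < r) (hT : 0 < T)
    (t : ℕ → ℝ) (ht0 : t 0 = 0) (htK : t (K + 1) = T)
    (htmono : ∀ k ≤ K, t k < t (k + 1))
    (u : ℝ → Fin n → ℝ)
    (hcont0 : ContinuousOn u (Icc (-r) 0))
    (hcont : ∀ k < K, ContinuousOn u (Ico (t k) (t (k + 1))))
    (hcontK : ContinuousOn u (Icc (t K) T))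
    (hleft : ∀ k, 1 ≤ k → k ≤ K →
      ∃ L, Tendsto u (nhdsWithin (t k) (Iio (t k))) (nhds L))
    (hinit : ∀ s ∈ Icc (-r) (0 : ℝ), ‖u s‖ ≤ a0)
    (hineq : ∀ k ≤ K, ∀ t' ∈ Ico (t k) (t (k + 1)), ‖u t'‖ ≤ ‖u (t k)‖ + a1 +
      b * ∫ s in (t k)..t', sSup ((fun ζ => ‖u ζ‖) '' Icc (-r) s))
    (hjump : ∀ k, 1 ≤ k → k ≤ K → ∀ L : Fin n → ℝ,
      Tendsto u (nhdsWithin (t k) (Iio (t k))) (nhds L) →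
      ‖u (t k) - L‖ ≤ c * ‖L‖ + a2) :
    ∀ s ∈ Icc (0 : ℝ) T,
      ‖u s‖ ≤ (∑ j ∈ Finset.range (K + 1), (1 + c) ^ j) * (a0 + a1 + a2) *
        Real.exp (b * s) := by
  set A := a0 + a1 + a2 with hA
  have hA0 : 0 ≤ A := by positivity
  set S : ℕ → ℝ := fun k => ∑ j ∈ Finset.range k, (1 + c) ^ j with hS
  have hS0 : ∀ k, 0 ≤ S k := fun k => Finset.sum_nonneg fun j _ => by positivity
  have hSsucc : ∀ k, S (k + 1) = (1 + c) * S k + 1 := fun k => by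
    simp only [hS, Finset.sum_range_succ', pow_succ', Finset.mul_sum, pow_zero]
  have hSle : ∀ k, S k ≤ S (k + 1) := fun k => by
    rw [hSsucc]; nlinarith [mul_nonneg hc (hS0 k)]
  have hS1 : ∀ k, 1 ≤ S (k + 1) := fun k => by
    rw [hSsucc]; nlinarith [mul_nonneg hc (hS0 k), hS0 k]
  have htnn : ∀ k ≤ K + 1, 0 ≤ t k := fun k => by
    induction k with
    | zero => intro _; exact ht0.ge
    | succ k ih => intro hk; exact (ih (by omega)).trans (htmono k (by omega)).le
  have hexp1 : ∀ x, 0 ≤ x → 1 ≤ Real.exp (b * x) := fun x hx =>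
    Real.one_le_exp (mul_nonneg hb hx)
  have hcontIco : ∀ k ≤ K, ContinuousOn u (Ico (t k) (t (k + 1))) := fun k hk => by
    rcases hk.lt_or_eq with h | rfl
    · exact hcont k h
    · rw [htK]; exact hcontK.mono Ico_subset_Icc_self
  have hmain : ∀ k ≤ K + 1, ∀ s ∈ Ico 0 (t k), ‖u s‖ ≤ S k * A * Real.exp (b * s) := by
    intro k
    induction k with
    | zero => intro _ s hs; rw [ht0] at hs; exact absurd hs.2 hs.1.not_gt
    | succ k ih =>
      intro hk
      have hk' : k ≤ K := by omega
      specialize ih (by omega)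
      have htk := htnn k (by omega)
      have hpast : ∀ s ∈ Ico (-r) (t k), ‖u s‖ ≤ S (k + 1) * A * Real.exp (b * t k) := by
        intro s hs
        rcases le_total s 0 with h | h
        · calc ‖u s‖ ≤ a0 := hinit s ⟨hs.1, h⟩
            _ ≤ 1 * A * 1 := by rw [hA]; linarith
            _ ≤ S (k + 1) * A * Real.exp (b * t k) := by
              gcongr
              exacts [hS1 k, hexp1 _ htk]
        · refine (ih s ⟨h, hs.2⟩).trans ?_
          have := hs.2.le
          gcongr
          exact hSle k
      have hp : ‖u (t k)‖ + a1 ≤ S (k + 1) * A * Real.exp (b * t k) := by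
        rcases Nat.eq_zero_or_pos k with rfl | hk0
        · have := hinit 0 ⟨by linarith, le_rfl⟩
          have h1 : S (0 + 1) = 1 := by simp [hS]
          rw [h1, ht0, mul_zero, Real.exp_zero]
          linarith
        · obtain ⟨L, hL⟩ := hleft k hk0 hk'
          have h0 : 0 < t k := by
            obtain ⟨j, rfl⟩ := Nat.exists_eq_succ_of_ne_zero hk0.ne'
            exact (htnn j (by omega)).trans_lt (htmono j (by omega))
          have hLn : ‖L‖ ≤ S k * A * Real.exp (b * t k) := by
            refine le_of_tendsto hL.norm ?_
            filter_upwards [Ioo_mem_nhdsLT h0] with s hs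
            refine (ih s ⟨hs.1.le, hs.2⟩).trans ?_
            have := hs.2.le
            have := hS0 k
            gcongr
          have hj := hjump k hk0 hk' L hL
          have htri : ‖u (t k)‖ ≤ ‖u (t k) - L‖ + ‖L‖ := norm_le_norm_sub_add _ _
          have hcL := mul_le_mul_of_nonneg_left hLn (add_nonneg zero_le_one hc)
          have hAe : A * 1 ≤ A * Real.exp (b * t k) :=
            mul_le_mul_of_nonneg_left (hexp1 _ htk) hA0
          rw [hSsucc]
          linarith
      intro s hs
      rcases lt_or_ge s (t k) with h | h
      · refine (ih s ⟨hs.1, h⟩).trans ?_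
        gcongr
        exact hSle k
      · have := norm_le_mul_exp_of_le_add_integral_sSup (by linarith) hb
          (hcontIco k hk') hpast hp (hineq k hk') s ⟨h, hs.2⟩
        rwa [mul_assoc, ← Real.exp_add, show b * t k + b * (s - t k) = b * s by ring] at this
  intro s hs
  have hlast := hmain (K + 1) le_rfl
  rw [htK] at hlast
  rcases hs.2.lt_or_eq with h | rfl
  · exact hlast s ⟨hs.1, h⟩
  · have hKs : t K < s := htK ▸ htmono K le_rfl
    have hu : Tendsto u (nhdsWithin s (Iio s)) (nhds (u s)) := by
      have := (hcontK s ⟨hKs.le, le_rfl⟩).mono Ico_subset_Icc_self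
      rwa [ContinuousWithinAt, nhdsWithin_Ico_eq_nhdsLT hKs] at this
    refine le_of_tendsto hu.norm ?_
    filter_upwards [Ioo_mem_nhdsLT hT] with x hx
    refine (hlast x ⟨hx.1.le, hx.2⟩).trans ?_
    have := hx.2.le
    have := hS0 (K + 1)
    gcongr
end

section
/- Assume (A1)–(A4) and λ>0, and let 0<h<h₀. If the solution (x_h,τ_h) of the EPCA impulsive initial value problem exists on (−∞,(j₀+1)h] up to the mesh point j₀h and satisfies τ_h(jh) ≥ 0 for j=0,1,…,j₀, then the EPCA impulsive initial value problem has a unique solution on the interval (−∞,(j₀+1)h]; in particular, between consecutive mesh points the values x_h((j+1)h−) and τ_h((j+1)h) are determined from x_h(jh), x_h(jh−[τ_h(jh)]_h) and τ_h(jh) by the explicit Euler-type recursion obtained by integrating the EPCA equations, with the jump I_k applied at an impulsive moment t_k lying in (jh,(j+1)h). -/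
open Set Filter MeasureTheory

/-- The piecewise-constant argument `[t]_h = ⌊t/h⌋·h`. -/
noncomputable def flr (h t : ℝ) : ℝ := ⌊t / h⌋ * h

/-- `(x, τ)` is a solution of the EPCA impulsive initial value problem
(with stepsize `h`) on `(-∞, β]`: the initial conditions `x = φ`, `τ = λ`
hold on `(-∞,0]`, `τ` is continuous on `[0,β]` and satisfies the integral
equation with piecewise-constant arguments, `x` is right-continuous, has
left limits at the impulsive moments `tI 1 < ⋯ < tI K` where it jumps by
`Imp k` applied to the left limit, and `x` satisfies the integral equation
with piecewise-constant arguments on every subinterval of `[0,β]` containing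
no impulsive moment. -/
def IsEPCASol (n K : ℕ) (f : ℝ → (Fin n → ℝ) → (Fin n → ℝ) → (Fin n → ℝ))
    (g : ℝ → (Fin n → ℝ) → ℝ → ℝ) (Imp : ℕ → (Fin n → ℝ) → (Fin n → ℝ))
    (φ : ℝ → (Fin n → ℝ)) (lam : ℝ) (tI : ℕ → ℝ)
    (h β : ℝ) (x : ℝ → (Fin n → ℝ)) (τ : ℝ → ℝ) : Prop :=
  (∀ t ≤ (0 : ℝ), x t = φ t) ∧ (∀ t ≤ (0 : ℝ), τ t = lam) ∧
  ContinuousOn τ (Icc 0 β) ∧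
  (∀ t ∈ Icc (0 : ℝ) β,
    τ t = lam + ∫ s in (0 : ℝ)..t, g (flr h s) (x (flr h s)) (τ (flr h s))) ∧
  (∀ t ∈ Icc (0 : ℝ) β, Tendsto x (nhdsWithin t (Ici t)) (nhds (x t))) ∧
  (∀ k, 1 ≤ k → k ≤ K → tI k ≤ β →
    ∃ ξ, Tendsto x (nhdsWithin (tI k) (Iio (tI k))) (nhds ξ) ∧
      x (tI k) = ξ + Imp k ξ) ∧
  (∀ a b : ℝ, 0 ≤ a → a ≤ b → b ≤ β →
    (∀ k, 1 ≤ k → k ≤ K → tI k ∉ Ioc a b) →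
    x b = x a + ∫ s in a..b,
      f (flr h s) (x (flr h s)) (x (flr h s - flr h (τ (flr h s)))))

/-- `(x, τ)` is a solution of the impulsive initial value problem with
state-dependent adaptive delay on `(-∞, β]`. -/
def IsIIVPSol (n K : ℕ) (f : ℝ → (Fin n → ℝ) → (Fin n → ℝ) → (Fin n → ℝ))
    (g : ℝ → (Fin n → ℝ) → ℝ → ℝ) (Imp : ℕ → (Fin n → ℝ) → (Fin n → ℝ))
    (φ : ℝ → (Fin n → ℝ)) (lam : ℝ) (tI : ℕ → ℝ)
    (β : ℝ) (x : ℝ → (Fin n → ℝ)) (τ : ℝ → ℝ) : Prop :=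
  (∀ t ≤ (0 : ℝ), x t = φ t) ∧ (∀ t ≤ (0 : ℝ), τ t = lam) ∧
  ContinuousOn τ (Icc 0 β) ∧
  (∀ t ∈ Icc (0 : ℝ) β, τ t = lam + ∫ s in (0 : ℝ)..t, g s (x s) (τ s)) ∧
  (∀ t ∈ Icc (0 : ℝ) β, Tendsto x (nhdsWithin t (Ici t)) (nhds (x t))) ∧
  (∀ k, 1 ≤ k → k ≤ K → tI k ≤ β →
    ∃ ξ, Tendsto x (nhdsWithin (tI k) (Iio (tI k))) (nhds ξ) ∧
      x (tI k) = ξ + Imp k ξ) ∧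
  (∀ a b : ℝ, 0 ≤ a → a ≤ b → b ≤ β →
    (∀ k, 1 ≤ k → k ≤ K → tI k ∉ Ioc a b) →
    x b = x a + ∫ s in a..b, f s (x s) (x (s - τ s)))

/-- (A1): `f` is continuous on `[0,T]×ℝⁿ×ℝⁿ` and locally Lipschitz
continuous in its second and third arguments. -/
def AssumptionA1 (n : ℕ) (T : ℝ)
    (f : ℝ → (Fin n → ℝ) → (Fin n → ℝ) → (Fin n → ℝ)) : Prop :=
  ContinuousOn (fun p : ℝ × (Fin n → ℝ) × (Fin n → ℝ) => f p.1 p.2.1 p.2.2)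
    (Icc 0 T ×ˢ (univ : Set (Fin n → ℝ)) ×ˢ (univ : Set (Fin n → ℝ))) ∧
  ∀ M : ℝ, 0 < M → ∃ L : ℝ, 0 ≤ L ∧ ∀ t ∈ Icc (0 : ℝ) T,
    ∀ u ub v vb : Fin n → ℝ, ‖u‖ ≤ M → ‖ub‖ ≤ M → ‖v‖ ≤ M → ‖vb‖ ≤ M →
      ‖f t u v - f t ub vb‖ ≤ L * (‖u - ub‖ + ‖v - vb‖)

/-- (A2): `g` is continuous on `[0,T]×ℝⁿ×ℝ`, is positive when its last
argument vanishes, and is locally Lipschitz continuous in its second and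
third arguments. -/
def AssumptionA2 (n : ℕ) (T : ℝ) (g : ℝ → (Fin n → ℝ) → ℝ → ℝ) : Prop :=
  ContinuousOn (fun p : ℝ × (Fin n → ℝ) × ℝ => g p.1 p.2.1 p.2.2)
    (Icc 0 T ×ˢ (univ : Set (Fin n → ℝ)) ×ˢ (univ : Set ℝ)) ∧
  (∀ t ∈ Icc (0 : ℝ) T, ∀ u : Fin n → ℝ, 0 < g t u 0) ∧
  ∀ M : ℝ, 0 < M → ∃ L : ℝ, 0 ≤ L ∧ ∀ t ∈ Icc (0 : ℝ) T,
    ∀ u ub : Fin n → ℝ, ∀ w wb : ℝ, ‖u‖ ≤ M → ‖ub‖ ≤ M → |w| ≤ M → |wb| ≤ M →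
      |g t u w - g t ub wb| ≤ L * (‖u - ub‖ + |w - wb|)

/-- (A3): the impulse functions `I_k`, `k = 1,…,K`, are globally Lipschitz
continuous with a common Lipschitz constant. -/
def AssumptionA3 (n K : ℕ) (Imp : ℕ → (Fin n → ℝ) → (Fin n → ℝ)) : Prop :=
  ∃ L : ℝ, 0 ≤ L ∧ ∀ k, 1 ≤ k → k ≤ K → ∀ u ub : Fin n → ℝ,
    ‖Imp k u - Imp k ub‖ ≤ L * ‖u - ub‖

/-- (A4): the initial function `φ` is bounded on `(-∞,0]` and locally
piecewise Lipschitz continuous, with possible jump discontinuities only at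
the points of the strictly decreasing sequence `0 = tm 0 > tm 1 > ⋯ → -∞`,
where it is right-continuous. -/
def AssumptionA4 (n : ℕ) (φ : ℝ → (Fin n → ℝ)) (tm : ℕ → ℝ) : Prop :=
  tm 0 = 0 ∧ StrictAnti tm ∧ Tendsto tm atTop atBot ∧
  (∀ k : ℕ, Tendsto φ (nhdsWithin (tm k) (Ioi (tm k))) (nhds (φ (tm k)))) ∧
  (∃ N : ℝ, 0 ≤ N ∧ ∀ s ≤ (0 : ℝ), ‖φ s‖ ≤ N) ∧
  (∀ M : ℝ, 0 < M → ∃ L : ℝ, 0 ≤ L ∧ ∀ k : ℕ,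
    ∀ s ∈ Ico (tm (k + 1)) (tm k) ∩ Icc (-M) 0,
    ∀ sb ∈ Ico (tm (k + 1)) (tm k) ∩ Icc (-M) 0,
      ‖φ s - φ sb‖ ≤ L * |s - sb|)

/-! ### Functions of the piecewise-constant argument -/

lemma flr_eq_of_mem_Ico {h s : ℝ} (hh : 0 < h) {j : ℕ}
    (hs : s ∈ Ico ((j : ℝ) * h) (((j : ℝ) + 1) * h)) : flr h s = (j : ℝ) * h := by
  have : ⌊s / h⌋ = (j : ℤ) := by
    rw [Int.floor_eq_iff]
    refine ⟨?_, ?_⟩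
    · rw [le_div_iff₀ hh]; exact_mod_cast hs.1
    · rw [div_lt_iff₀ hh]; exact_mod_cast hs.2
  simp [flr, this]

lemma flr_nonneg {h t : ℝ} (hh : 0 < h) (ht : 0 ≤ t) : 0 ≤ flr h t :=
  mul_nonneg (by exact_mod_cast Int.floor_nonneg.2 (div_nonneg ht hh.le)) hh.le

lemma exists_flr_eq {h s : ℝ} (hh : 0 < h) {j0 : ℕ} (hs0 : 0 ≤ s)
    (hs : s < ((j0 : ℝ) + 1) * h) : ∃ i ≤ j0, flr h s = (i : ℝ) * h := by
  have h0 : 0 ≤ s / h := div_nonneg hs0 hh.le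
  have h1 : ⌊s / h⌋₊ < j0 + 1 := by
    rw [Nat.floor_lt h0, div_lt_iff₀ hh]; exact_mod_cast hs
  refine ⟨⌊s / h⌋₊, by omega, flr_eq_of_mem_Ico hh ⟨?_, ?_⟩⟩
  · rw [← le_div_iff₀ hh]; exact Nat.floor_le h0
  · rw [← div_lt_iff₀ hh]; exact Nat.lt_floor_add_one _

section StepFunctions

variable {E : Type*}

lemma ae_step_eq (Φ : ℝ → E) {h a b : ℝ} (hh : 0 < h) {j : ℕ} (ha : (j : ℝ) * h ≤ a)
    (hab : a ≤ b) (hb : b ≤ ((j : ℝ) + 1) * h) :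
    ∀ᵐ s, s ∈ uIoc a b → Φ (flr h s) = Φ ((j : ℝ) * h) := by
  have : ∀ᵐ s : ℝ, s ≠ b := by simp [ae_iff]
  filter_upwards [this] with s hsb hs
  rw [uIoc_of_le hab] at hs
  rw [flr_eq_of_mem_Ico hh ⟨ha.trans hs.1.le, (lt_of_le_of_ne hs.2 hsb).trans_le hb⟩]

lemma integral_step [NormedAddCommGroup E] [NormedSpace ℝ E] [CompleteSpace E]
    (Φ : ℝ → E) {h a b : ℝ} (hh : 0 < h) {j : ℕ}
    (ha : (j : ℝ) * h ≤ a) (hab : a ≤ b) (hb : b ≤ ((j : ℝ) + 1) * h) :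
    ∫ s in a..b, Φ (flr h s) = (b - a) • Φ ((j : ℝ) * h) := by
  rw [intervalIntegral.integral_congr_ae (ae_step_eq Φ hh ha hab hb),
    intervalIntegral.integral_const]

lemma intervalIntegrable_step_cell [NormedAddCommGroup E] (Φ : ℝ → E) {h a b : ℝ}
    (hh : 0 < h) {j : ℕ}
    (ha : (j : ℝ) * h ≤ a) (hab : a ≤ b) (hb : b ≤ ((j : ℝ) + 1) * h) :
    IntervalIntegrable (fun s => Φ (flr h s)) volume a b := by
  refine (intervalIntegrable_const (c := Φ ((j : ℝ) * h))).congr_ae ?_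
  rw [Filter.EventuallyEq, ae_restrict_iff' measurableSet_uIoc]
  filter_upwards [ae_step_eq Φ hh ha hab hb] with s hs hm using (hs hm).symm

lemma intervalIntegrable_step [NormedAddCommGroup E] (Φ : ℝ → E) {h a b : ℝ}
    (hh : 0 < h) {j : ℕ} (ha : 0 ≤ a)
    (hab : a ≤ b) (hb : b ≤ (j : ℝ) * h) :
    IntervalIntegrable (fun s => Φ (flr h s)) volume a b := by
  have key : IntervalIntegrable (fun s => Φ (flr h s)) volume
      (((0 : ℕ) : ℝ) * h) ((j : ℝ) * h) := by
    refine IntervalIntegrable.trans_iterate (a := fun i : ℕ => (i : ℝ) * h) fun i _ => ?_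
    refine intervalIntegrable_step_cell Φ hh (j := i) le_rfl ?_ ?_ <;> push_cast <;> nlinarith
  refine key.mono_set ?_
  rw [uIcc_of_le hab, uIcc_of_le (by push_cast; linarith)]
  exact Icc_subset_Icc (by simpa using ha) hb

lemma integral_step_congr [NormedAddCommGroup E] [NormedSpace ℝ E] {Φ Ψ : ℝ → E}
    {h a b : ℝ} (hh : 0 < h) {j0 : ℕ} (ha : 0 ≤ a)
    (hab : a ≤ b) (hb : b ≤ ((j0 : ℝ) + 1) * h)
    (hΦ : ∀ i ≤ j0, Φ ((i : ℝ) * h) = Ψ ((i : ℝ) * h)) :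
    ∫ s in a..b, Φ (flr h s) = ∫ s in a..b, Ψ (flr h s) := by
  refine intervalIntegral.integral_congr_ae ?_
  have : ∀ᵐ s : ℝ, s ≠ b := by simp [ae_iff]
  filter_upwards [this] with s hsb hs
  rw [uIoc_of_le hab] at hs
  obtain ⟨i, hi, his⟩ := exists_flr_eq hh (ha.trans hs.1.le)
    ((lt_of_le_of_ne hs.2 hsb).trans_le hb)
  rw [his, hΦ i hi]

end StepFunctions

/-! ### Properties of solutions -/

/-- The slope of the state component of an EPCA solution, as a function of the mesh point. -/
noncomputable def stateSlope {n : ℕ} (f : ℝ → (Fin n → ℝ) → (Fin n → ℝ) → (Fin n → ℝ)) (h : ℝ)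
    (x : ℝ → (Fin n → ℝ)) (τ : ℝ → ℝ) (r : ℝ) : Fin n → ℝ :=
  f r (x r) (x (r - flr h (τ r)))

lemma stateSlope_congr {n : ℕ} {f : ℝ → (Fin n → ℝ) → (Fin n → ℝ) → (Fin n → ℝ)} {h r : ℝ}
    {x x' : ℝ → (Fin n → ℝ)} {τ τ' : ℝ → ℝ} (hh : 0 < h)
    (hx : ∀ t ≤ r, x' t = x t) (hτ : τ' r = τ r) (hnn : 0 ≤ τ r) :
    stateSlope f h x' τ' r = stateSlope f h x τ r := by
  have := flr_nonneg hh hnn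
  rw [stateSlope, stateSlope, hτ, hx r le_rfl, hx _ (by linarith)]

namespace IsEPCASol

variable {n K : ℕ} {f : ℝ → (Fin n → ℝ) → (Fin n → ℝ) → (Fin n → ℝ)}
  {g : ℝ → (Fin n → ℝ) → ℝ → ℝ} {Imp : ℕ → (Fin n → ℝ) → (Fin n → ℝ)}
  {φ : ℝ → (Fin n → ℝ)} {lam : ℝ} {tI : ℕ → ℝ} {h β : ℝ}
  {x x' : ℝ → (Fin n → ℝ)} {τ τ' : ℝ → ℝ}

lemma mono (hs : IsEPCASol n K f g Imp φ lam tI h β x τ) {β' : ℝ} (hβ : β' ≤ β) :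
    IsEPCASol n K f g Imp φ lam tI h β' x τ := by
  obtain ⟨h1, h2, h3, h4, h5, h6, h7⟩ := hs
  exact ⟨h1, h2, h3.mono (Icc_subset_Icc_right hβ), fun t ht => h4 t ⟨ht.1, ht.2.trans hβ⟩,
    fun t ht => h5 t ⟨ht.1, ht.2.trans hβ⟩, fun k hk hK ht => h6 k hk hK (ht.trans hβ),
    fun a b ha hab hb => h7 a b ha hab (hb.trans hβ)⟩

lemma delay_eq (hs : IsEPCASol n K f g Imp φ lam tI h β x τ) (hh : 0 < h) {j : ℕ} {t : ℝ}
    (h1 : (j : ℝ) * h ≤ t) (h2 : t ≤ ((j : ℝ) + 1) * h) (h3 : t ≤ β) :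
    τ t = τ ((j : ℝ) * h) +
      (t - (j : ℝ) * h) * g ((j : ℝ) * h) (x ((j : ℝ) * h)) (τ ((j : ℝ) * h)) := by
  have hj : 0 ≤ (j : ℝ) * h := by positivity
  have hτ := hs.2.2.2.1
  rw [hτ t ⟨hj.trans h1, h3⟩, ← intervalIntegral.integral_add_adjacent_intervals
    (intervalIntegrable_step (fun r => g r (x r) (τ r)) hh le_rfl hj le_rfl)
    (intervalIntegrable_step_cell (fun r => g r (x r) (τ r)) hh le_rfl h1 h2),
    integral_step (fun r => g r (x r) (τ r)) hh le_rfl h1 h2, ← add_assoc,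
    ← hτ _ ⟨hj, h1.trans h3⟩, smul_eq_mul]

lemma state_eq (hs : IsEPCASol n K f g Imp φ lam tI h β x τ) (hh : 0 < h) {j : ℕ} {a t : ℝ}
    (ha : (j : ℝ) * h ≤ a) (h1 : a ≤ t) (h2 : t ≤ ((j : ℝ) + 1) * h) (h3 : t ≤ β)
    (hno : ∀ k, 1 ≤ k → k ≤ K → tI k ∉ Ioc a t) :
    x t = x a + (t - a) • stateSlope f h x τ ((j : ℝ) * h) := by
  have hj : 0 ≤ (j : ℝ) * h := by positivity
  rw [hs.2.2.2.2.2.2 a t (hj.trans ha) h1 h3 hno,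
    ← integral_step (stateSlope f h x τ) hh ha h1 h2]
  rfl

lemma state_impulse_eq (hs : IsEPCASol n K f g Imp φ lam tI h β x τ) (hh : 0 < h) {j k : ℕ}
    (hk : 1 ≤ k) (hK : k ≤ K) (h1 : (j : ℝ) * h < tI k) (h2 : tI k ≤ ((j : ℝ) + 1) * h)
    (h3 : tI k ≤ β)
    (hsep : ∀ i, 1 ≤ i → i ≤ K → tI i ∈ Ioc ((j : ℝ) * h) (((j : ℝ) + 1) * h) → i = k) :
    x (tI k) = (x ((j : ℝ) * h) +
        (tI k - (j : ℝ) * h) • stateSlope f h x τ ((j : ℝ) * h)) +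
      Imp k (x ((j : ℝ) * h) +
        (tI k - (j : ℝ) * h) • stateSlope f h x τ ((j : ℝ) * h)) := by
  obtain ⟨ξ, hξ, hx⟩ := hs.2.2.2.2.2.1 k hk hK h3
  have hev : (fun t => x ((j : ℝ) * h) +
      (t - (j : ℝ) * h) • stateSlope f h x τ ((j : ℝ) * h)) =ᶠ[nhdsWithin (tI k) (Iio (tI k))]
      x := by
    filter_upwards [Ioo_mem_nhdsLT h1] with t ht
    refine (hs.state_eq hh le_rfl ht.1.le (ht.2.le.trans h2) (ht.2.le.trans h3)
      fun i hi hiK him => ?_).symm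
    obtain rfl := hsep i hi hiK ⟨him.1, him.2.trans (ht.2.le.trans h2)⟩
    exact absurd ht.2 (not_lt.2 him.2)
  have hlim : Tendsto (fun t => x ((j : ℝ) * h) +
      (t - (j : ℝ) * h) • stateSlope f h x τ ((j : ℝ) * h)) (nhdsWithin (tI k) (Iio (tI k)))
      (nhds (x ((j : ℝ) * h) +
        (tI k - (j : ℝ) * h) • stateSlope f h x τ ((j : ℝ) * h))) :=
    (Continuous.tendsto (by fun_prop) _).mono_left nhdsWithin_le_nhds
  rw [hx, tendsto_nhds_unique hξ (hlim.congr' hev)]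

lemma state_eq_after_impulse (hs : IsEPCASol n K f g Imp φ lam tI h β x τ) (hh : 0 < h)
    {j k : ℕ} {t : ℝ} (h1 : (j : ℝ) * h < tI k) (ht : tI k ≤ t)
    (h2 : t ≤ ((j : ℝ) + 1) * h) (h3 : t ≤ β)
    (hsep : ∀ i, 1 ≤ i → i ≤ K → tI i ∈ Ioc ((j : ℝ) * h) (((j : ℝ) + 1) * h) → i = k) :
    x t = x (tI k) + (t - tI k) • stateSlope f h x τ ((j : ℝ) * h) := by
  refine hs.state_eq hh h1.le ht h2 h3 fun i hi hiK him => ?_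
  obtain rfl := hsep i hi hiK ⟨h1.trans him.1, him.2.trans h2⟩
  exact lt_irrefl _ him.1

lemma eq_succ (hs : IsEPCASol n K f g Imp φ lam tI h β x τ)
    (hs' : IsEPCASol n K f g Imp φ lam tI h β x' τ') (hh : 0 < h) {j : ℕ}
    (hβ : ((j : ℝ) + 1) * h ≤ β)
    (hsep : ∀ k i, 1 ≤ k → k ≤ K → tI k ∈ Ioc ((j : ℝ) * h) (((j : ℝ) + 1) * h) →
      1 ≤ i → i ≤ K → tI i ∈ Ioc ((j : ℝ) * h) (((j : ℝ) + 1) * h) → i = k)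
    (hnn : 0 ≤ τ ((j : ℝ) * h))
    (heq : ∀ t ≤ (j : ℝ) * h, x' t = x t ∧ τ' t = τ t) :
    ∀ t ≤ ((j : ℝ) + 1) * h, x' t = x t ∧ τ' t = τ t := by
  intro t ht
  rcases le_or_gt t ((j : ℝ) * h) with htj | htj
  · exact heq t htj
  obtain ⟨hxj, hτj⟩ := heq _ le_rfl
  have hslope : stateSlope f h x' τ' ((j : ℝ) * h) = stateSlope f h x τ ((j : ℝ) * h) :=
    stateSlope_congr hh (fun s hs => (heq s hs).1) hτj hnn
  constructor
  · by_cases hex : ∃ k, 1 ≤ k ∧ k ≤ K ∧ tI k ∈ Ioc ((j : ℝ) * h) t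
    · obtain ⟨k, hk, hK, hkt⟩ := hex
      have hsepk := fun i => hsep k i hk hK ⟨hkt.1, hkt.2.trans ht⟩
      rw [hs.state_eq_after_impulse hh hkt.1 hkt.2 ht (ht.trans hβ) hsepk,
        hs'.state_eq_after_impulse hh hkt.1 hkt.2 ht (ht.trans hβ) hsepk,
        hs.state_impulse_eq hh hk hK hkt.1 (hkt.2.trans ht) (hkt.2.trans (ht.trans hβ)) hsepk,
        hs'.state_impulse_eq hh hk hK hkt.1 (hkt.2.trans ht) (hkt.2.trans (ht.trans hβ)) hsepk,
        hslope, hxj]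
    · have hno : ∀ k, 1 ≤ k → k ≤ K → tI k ∉ Ioc ((j : ℝ) * h) t :=
        fun k hk hK hm => hex ⟨k, hk, hK, hm⟩
      rw [hs.state_eq hh le_rfl htj.le ht (ht.trans hβ) hno,
        hs'.state_eq hh le_rfl htj.le ht (ht.trans hβ) hno, hslope, hxj]
  · rw [hs.delay_eq hh htj.le ht (ht.trans hβ), hs'.delay_eq hh htj.le ht (ht.trans hβ),
      hxj, hτj]

/-- Two solutions up to a mesh point agree if the delay of one of them is nonnegative at all
earlier mesh points. -/
lemma eq_of_nonneg {j0 : ℕ} (hs : IsEPCASol n K f g Imp φ lam tI h ((j0 : ℝ) * h) x τ)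
    (hs' : IsEPCASol n K f g Imp φ lam tI h ((j0 : ℝ) * h) x' τ') (hh : 0 < h)
    (hsep : ∀ j < j0, ∀ k i, 1 ≤ k → k ≤ K →
      tI k ∈ Ioc ((j : ℝ) * h) (((j : ℝ) + 1) * h) →
      1 ≤ i → i ≤ K → tI i ∈ Ioc ((j : ℝ) * h) (((j : ℝ) + 1) * h) → i = k)
    (hnn : ∀ j < j0, 0 ≤ τ ((j : ℝ) * h)) :
    ∀ t ≤ (j0 : ℝ) * h, x' t = x t ∧ τ' t = τ t := by
  suffices H : ∀ j ≤ j0, ∀ t ≤ (j : ℝ) * h, x' t = x t ∧ τ' t = τ t from H j0 le_rfl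
  intro j
  induction j with
  | zero =>
    intro _ t ht
    have ht0 : t ≤ 0 := by simpa using ht
    exact ⟨(hs'.1 t ht0).trans (hs.1 t ht0).symm, (hs'.2.1 t ht0).trans (hs.2.1 t ht0).symm⟩
  | succ j ih =>
    intro hj
    have hlt : j < j0 := hj
    have hjR : (j : ℝ) + 1 ≤ j0 := by exact_mod_cast hj
    push_cast
    exact hs.eq_succ hs' hh (mul_le_mul_of_nonneg_right hjR hh.le) (hsep j hlt) (hnn j hlt)
      (ih hlt.le)

/-- A solution up to a mesh point `j0 * h` with nonnegative delays at the mesh points extends to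
the next mesh point. The point `p` is the impulsive moment between the two mesh points, where the
state jumps by `J`; a value of `p` beyond the next mesh point means that there is none. -/
lemma extend {j0 : ℕ} (hs : IsEPCASol n K f g Imp φ lam tI h ((j0 : ℝ) * h) x τ) (hh : 0 < h)
    (hnn : ∀ j ≤ j0, 0 ≤ τ ((j : ℝ) * h)) {p : ℝ} {J : Fin n → ℝ} (hp : (j0 : ℝ) * h < p)
    (hpI : p ≤ ((j0 : ℝ) + 1) * h → ∃ k, 1 ≤ k ∧ k ≤ K ∧ tI k = p)
    (hJ : ∀ k, 1 ≤ k → k ≤ K → tI k ∈ Ioc ((j0 : ℝ) * h) (((j0 : ℝ) + 1) * h) →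
      tI k = p ∧ J = Imp k (x ((j0 : ℝ) * h) +
        (p - (j0 : ℝ) * h) • stateSlope f h x τ ((j0 : ℝ) * h))) :
    ∃ x' τ', IsEPCASol n K f g Imp φ lam tI h (((j0 : ℝ) + 1) * h) x' τ' ∧
      ∀ t ≤ (j0 : ℝ) * h, x' t = x t ∧ τ' t = τ t := by
  have hj : 0 ≤ (j0 : ℝ) * h := by positivity
  have hAB : (j0 : ℝ) * h ≤ ((j0 : ℝ) + 1) * h := by linarith
  obtain ⟨s1, s2, s3, s4, s5, s6, s7⟩ := hs
  set A : ℝ := (j0 : ℝ) * h with hA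
  set B : ℝ := ((j0 : ℝ) + 1) * h with hB
  set F := stateSlope f h x τ A with hF
  set G := g A (x A) (τ A) with hG
  let x' : ℝ → (Fin n → ℝ) := fun t =>
    x (min t A) + (max t A - A) • F + if p ≤ t then J else 0
  let τ' : ℝ → ℝ := fun t => τ (min t A) + (max t A - A) * G
  have hx'l : ∀ t ≤ A, x' t = x t := fun t ht => by
    simp [x', min_eq_left ht, max_eq_right ht, not_le.2 (ht.trans_lt hp)]
  have hτ'l : ∀ t ≤ A, τ' t = τ t := fun t ht => by
    simp [τ', min_eq_left ht, max_eq_right ht]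
  have hx'r : ∀ t, A ≤ t → x' t = x A + (t - A) • F + if p ≤ t then J else 0 := fun t ht => by
    simp [x', min_eq_right ht, max_eq_left ht]
  have hτ'r : ∀ t, A ≤ t → τ' t = τ A + (t - A) * G := fun t ht => by
    simp [τ', min_eq_right ht, max_eq_left ht]
  have hmesh : ∀ i ≤ j0, (i : ℝ) * h ≤ A := fun i hi =>
    mul_le_mul_of_nonneg_right (by exact_mod_cast hi) hh.le
  have hslope : ∀ i ≤ j0, stateSlope f h x' τ' ((i : ℝ) * h) =
      stateSlope f h x τ ((i : ℝ) * h) := fun i hi =>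
    stateSlope_congr hh (fun t ht => hx'l t (ht.trans (hmesh i hi))) (hτ'l _ (hmesh i hi))
      (hnn i hi)
  have hgeq : ∀ i ≤ j0, (fun r => g r (x' r) (τ' r)) ((i : ℝ) * h) =
      (fun r => g r (x r) (τ r)) ((i : ℝ) * h) := fun i hi => by
    simp only [hx'l _ (hmesh i hi), hτ'l _ (hmesh i hi)]
  have hstate : ∀ a b : ℝ, A ≤ a → a ≤ b → b ≤ B →
      (∀ k, 1 ≤ k → k ≤ K → tI k ∉ Ioc a b) →
      x' b = x' a + ∫ s in a..b, stateSlope f h x τ (flr h s) := by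
    intro a b ha hab hb hno
    have hiff : p ≤ b ↔ p ≤ a := by
      refine ⟨fun hpb => ?_, fun hpa => hpa.trans hab⟩
      by_contra! hap
      obtain ⟨k, hk, hK, rfl⟩ := hpI (hpb.trans hb)
      exact hno k hk hK ⟨hap, hpb⟩
    rw [integral_step (stateSlope f h x τ) hh ha hab hb, hx'r b (ha.trans hab), hx'r a ha]
    simp only [hiff]
    rw [show b - A = (a - A) + (b - a) by ring, add_smul]
    abel
  refine ⟨x', τ', ⟨fun t ht => (hx'l t (ht.trans hj)).trans (s1 t ht),
    fun t ht => (hτ'l t (ht.trans hj)).trans (s2 t ht), ?_, ?_, ?_, ?_, ?_⟩,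
    fun t ht => ⟨hx'l t ht, hτ'l t ht⟩⟩
  · refine ContinuousOn.add (s3.comp (by fun_prop) fun t ht => ?_) (by fun_prop)
    exact ⟨le_min ht.1 hj, min_le_right _ _⟩
  · intro t ht
    rw [integral_step_congr (Φ := fun r => g r (x' r) (τ' r)) (Ψ := fun r => g r (x r) (τ r))
      hh le_rfl ht.1 ht.2 hgeq]
    rcases le_total t A with htA | htA
    · rw [hτ'l t htA]
      exact s4 t ⟨ht.1, htA⟩
    · rw [hτ'r t htA, ← intervalIntegral.integral_add_adjacent_intervals
        (intervalIntegrable_step (fun r => g r (x r) (τ r)) hh le_rfl hj hA.le)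
        (intervalIntegrable_step_cell (fun r => g r (x r) (τ r)) hh hA.ge htA ht.2),
        integral_step (fun r => g r (x r) (τ r)) hh hA.ge htA ht.2, ← add_assoc,
        ← s4 A ⟨hj, le_rfl⟩, smul_eq_mul]
  · intro t ht
    rcases lt_or_ge t A with htA | htA
    · rw [hx'l t htA.le]
      refine (s5 t ⟨ht.1, htA.le⟩).congr' ?_
      filter_upwards [mem_nhdsWithin_of_mem_nhds (Iio_mem_nhds htA)] with s hs
      exact (hx'l s (le_of_lt hs)).symm
    · rw [hx'r t htA]
      have hlin : Tendsto (fun s => x A + (s - A) • F + if p ≤ t then J else 0)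
          (nhdsWithin t (Ici t)) (nhds (x A + (t - A) • F + if p ≤ t then J else 0)) :=
        (Continuous.tendsto (by fun_prop) t).mono_left nhdsWithin_le_nhds
      refine hlin.congr' ?_
      rcases le_or_gt p t with hpt | hpt
      · filter_upwards [self_mem_nhdsWithin] with s hs
        have hts : t ≤ s := hs
        rw [hx'r s (htA.trans hts), if_pos hpt, if_pos (hpt.trans hts)]
      · filter_upwards [self_mem_nhdsWithin, mem_nhdsWithin_of_mem_nhds (Iio_mem_nhds hpt)]
          with s hs hsp
        rw [hx'r s (htA.trans hs), if_neg (not_le.2 hpt), if_neg (not_le.2 hsp)]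
  · intro k hk hK hkB
    rcases le_or_gt (tI k) A with hkA | hkA
    · obtain ⟨ξ, hξ, hx⟩ := s6 k hk hK hkA
      refine ⟨ξ, hξ.congr' ?_, (hx'l _ hkA).trans hx⟩
      filter_upwards [self_mem_nhdsWithin] with s hs
      exact (hx'l s ((le_of_lt hs).trans hkA)).symm
    · obtain ⟨rfl, hJk⟩ := hJ k hk hK ⟨hkA, hkB⟩
      refine ⟨x A + (tI k - A) • F, ?_, by rw [hx'r _ hkA.le, if_pos le_rfl, ← hJk]⟩
      have hlin : Tendsto (fun s => x A + (s - A) • F) (nhdsWithin (tI k) (Iio (tI k)))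
          (nhds (x A + (tI k - A) • F)) :=
        (Continuous.tendsto (by fun_prop) _).mono_left nhdsWithin_le_nhds
      refine hlin.congr' ?_
      filter_upwards [Ioo_mem_nhdsLT hkA] with s hs
      rw [hx'r s hs.1.le, if_neg (not_le.2 hs.2), add_zero]
  · intro a b ha hab hb hno
    change x' b = x' a + ∫ s in a..b, stateSlope f h x' τ' (flr h s)
    rw [integral_step_congr hh ha hab hb hslope]
    rcases le_total b A with hbA | hbA
    · rw [hx'l b hbA, hx'l a (hab.trans hbA)]
      exact s7 a b ha hab hbA hno
    rcases le_total A a with haA | haA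
    · exact hstate a b haA hab hb hno
    · rw [← intervalIntegral.integral_add_adjacent_intervals
        (intervalIntegrable_step (stateSlope f h x τ) hh ha haA hA.le)
        (intervalIntegrable_step_cell (stateSlope f h x τ) hh hA.ge hbA hb), ← add_assoc,
        hstate A b le_rfl hbA hb fun k hk hK hm => hno k hk hK ⟨haA.trans_lt hm.1, hm.2⟩,
        hx'l A le_rfl, hx'l a haA]
      congr 1
      exact s7 a A ha haA le_rfl fun k hk hK hm => hno k hk hK ⟨hm.1, hm.2.trans hbA⟩

end IsEPCASol

/-- An interval shorter than all gaps between consecutive points contains at most one of them. -/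
lemma index_eq_of_mem_Ioc {K : ℕ} {tI : ℕ → ℝ} {h A B : ℝ} (hh : 0 ≤ h)
    (hgap : ∀ k ≤ K, h < tI (k + 1) - tI k) (hAB : B - A ≤ h) {i k : ℕ}
    (hi : i ≤ K) (hk : k ≤ K) (him : tI i ∈ Ioc A B) (hkm : tI k ∈ Ioc A B) : i = k := by
  have key : ∀ {i k : ℕ}, i < k → k ≤ K → tI i + h < tI k := by
    intro i k hik
    induction k, hik using Nat.le_induction with
    | base => intro hk; linarith [hgap i (by omega)]
    | succ k hik ih => intro hk; linarith [hgap k (by omega), ih (by omega)]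
  rcases lt_trichotomy i k with hlt | heq | hgt
  · linarith [key hlt hk, him.1, hkm.2]
  · exact heq
  · linarith [key hgt hi, hkm.1, him.2]

/-- Remark 3.1: under (A1)–(A4), with `λ > 0` and stepsize `0 < h < h₀`
(`h₀` the minimal gap between consecutive points of
`0 = tI 0 < tI 1 < ⋯ < tI K < tI (K+1) = T`), if the EPCA impulsive initial
value problem has a solution on `(-∞, j₀h]` whose delay component is
nonnegative at the mesh points `jh`, `j = 0,…,j₀`, then it has a unique
solution on `(-∞,(j₀+1)h]`; in particular, the values of any solution at the
mesh points are determined by the explicit Euler-type recursion obtained by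
integrating the EPCA equations, with the jump `I_k` applied at an impulsive
moment `t_k` lying between consecutive mesh points. -/
theorem stmt2 (n K : ℕ) (T lam : ℝ) (hT : 0 < T) (hlam : 0 < lam)
    (f : ℝ → (Fin n → ℝ) → (Fin n → ℝ) → (Fin n → ℝ))
    (g : ℝ → (Fin n → ℝ) → ℝ → ℝ) (Imp : ℕ → (Fin n → ℝ) → (Fin n → ℝ))
    (φ : ℝ → (Fin n → ℝ)) (tm : ℕ → ℝ)
    (hA1 : AssumptionA1 n T f) (hA2 : AssumptionA2 n T g)
    (hA3 : AssumptionA3 n K Imp) (hA4 : AssumptionA4 n φ tm)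
    (tI : ℕ → ℝ) (htI0 : tI 0 = 0) (htIK : tI (K + 1) = T)
    (htImono : ∀ k ≤ K, tI k < tI (k + 1))
    (h0 : ℝ) (hh0min : ∀ k ≤ K, h0 ≤ tI (k + 1) - tI k)
    (hh0mem : ∃ k ≤ K, h0 = tI (k + 1) - tI k)
    (h : ℝ) (hh : 0 < h) (hhh0 : h < h0)
    (j0 : ℕ) (hj0 : ((j0 : ℝ) + 1) * h ≤ T)
    (x : ℝ → (Fin n → ℝ)) (τ : ℝ → ℝ)
    (hsol : IsEPCASol n K f g Imp φ lam tI h ((j0 : ℝ) * h) x τ)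
    (hτnn : ∀ j ≤ j0, 0 ≤ τ ((j : ℝ) * h)) :
    (∃ x' τ', IsEPCASol n K f g Imp φ lam tI h (((j0 : ℝ) + 1) * h) x' τ' ∧
      ∀ t ≤ (j0 : ℝ) * h, x' t = x t ∧ τ' t = τ t) ∧
    (∀ x1 τ1 x2 τ2,
      IsEPCASol n K f g Imp φ lam tI h (((j0 : ℝ) + 1) * h) x1 τ1 →
      IsEPCASol n K f g Imp φ lam tI h (((j0 : ℝ) + 1) * h) x2 τ2 →
      ∀ t ≤ ((j0 : ℝ) + 1) * h, x1 t = x2 t ∧ τ1 t = τ2 t) ∧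
    (∀ x' τ', IsEPCASol n K f g Imp φ lam tI h (((j0 : ℝ) + 1) * h) x' τ' →
      ∀ j ≤ j0,
        τ' (((j : ℝ) + 1) * h) = τ' ((j : ℝ) * h) +
          h * g ((j : ℝ) * h) (x' ((j : ℝ) * h)) (τ' ((j : ℝ) * h)) ∧
        ((∀ k, 1 ≤ k → k ≤ K → tI k ∉ Ioc ((j : ℝ) * h) (((j : ℝ) + 1) * h)) →
          x' (((j : ℝ) + 1) * h) = x' ((j : ℝ) * h) +
            h • f ((j : ℝ) * h) (x' ((j : ℝ) * h))
              (x' ((j : ℝ) * h - flr h (τ' ((j : ℝ) * h))))) ∧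
        (∀ k, 1 ≤ k → k ≤ K → tI k ∈ Ioo ((j : ℝ) * h) (((j : ℝ) + 1) * h) →
          x' (tI k) =
            (x' ((j : ℝ) * h) + (tI k - (j : ℝ) * h) • f ((j : ℝ) * h)
              (x' ((j : ℝ) * h)) (x' ((j : ℝ) * h - flr h (τ' ((j : ℝ) * h))))) +
            Imp k (x' ((j : ℝ) * h) + (tI k - (j : ℝ) * h) • f ((j : ℝ) * h)
              (x' ((j : ℝ) * h)) (x' ((j : ℝ) * h - flr h (τ' ((j : ℝ) * h))))) ∧
          x' (((j : ℝ) + 1) * h) = x' (tI k) +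
            (((j : ℝ) + 1) * h - tI k) • f ((j : ℝ) * h) (x' ((j : ℝ) * h))
              (x' ((j : ℝ) * h - flr h (τ' ((j : ℝ) * h))))) ) := by
  have hgap : ∀ k ≤ K, h < tI (k + 1) - tI k := fun k hk => hhh0.trans_le (hh0min k hk)
  have hsep : ∀ j : ℕ, ∀ k i, 1 ≤ k → k ≤ K →
      tI k ∈ Ioc ((j : ℝ) * h) (((j : ℝ) + 1) * h) →
      1 ≤ i → i ≤ K → tI i ∈ Ioc ((j : ℝ) * h) (((j : ℝ) + 1) * h) → i = k :=
    fun j k i _ hK hkm _ hiK him =>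
      index_eq_of_mem_Ioc hh.le hgap (by linarith) hiK hK him hkm
  have hAB : (j0 : ℝ) * h ≤ ((j0 : ℝ) + 1) * h := by linarith
  refine ⟨?_, ?_, ?_⟩
  · by_cases hex : ∃ k, 1 ≤ k ∧ k ≤ K ∧ tI k ∈ Ioc ((j0 : ℝ) * h) (((j0 : ℝ) + 1) * h)
    · obtain ⟨k, hk, hK, hm⟩ := hex
      refine hsol.extend (J := Imp k (x ((j0 : ℝ) * h) + (tI k - (j0 : ℝ) * h) •
        stateSlope f h x τ ((j0 : ℝ) * h))) hh hτnn hm.1 (fun _ => ⟨k, hk, hK, rfl⟩) fun i hi hiK him => ?_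
      obtain rfl := hsep j0 k i hk hK hm hi hiK him
      exact ⟨rfl, rfl⟩
    · exact hsol.extend (p := ((j0 : ℝ) + 1) * h + 1) (J := 0) hh hτnn (by linarith)
        (fun hle => by linarith) fun k hk hK hm => absurd ⟨k, hk, hK, hm⟩ hex
  · intro x1 τ1 x2 τ2 hs1 hs2
    have heq1 := hsol.eq_of_nonneg (hs1.mono hAB) hh (fun j _ => hsep j)
      fun j hj => hτnn j hj.le
    have heq2 := hsol.eq_of_nonneg (hs2.mono hAB) hh (fun j _ => hsep j)
      fun j hj => hτnn j hj.le
    refine hs2.eq_succ hs1 hh le_rfl (hsep j0) ?_ fun t ht => ?_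
    · rw [(heq2 _ le_rfl).2]
      exact hτnn j0 le_rfl
    · exact ⟨(heq1 t ht).1.trans (heq2 t ht).1.symm, (heq1 t ht).2.trans (heq2 t ht).2.symm⟩
  · intro x' τ' hs j hj
    have hjR : (j : ℝ) ≤ j0 := by exact_mod_cast hj
    have hle : ((j : ℝ) + 1) * h ≤ ((j0 : ℝ) + 1) * h := by gcongr
    have hcell : (j : ℝ) * h ≤ ((j : ℝ) + 1) * h := by linarith
    have hlen : ((j : ℝ) + 1) * h - (j : ℝ) * h = h := by ring
    refine ⟨?_, fun hno => ?_, fun k hk hK hm => ?_⟩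
    · rw [hs.delay_eq hh hcell le_rfl hle, hlen]
    · rw [hs.state_eq hh le_rfl hcell le_rfl hle hno, hlen]
      rfl
    · have hsepk := fun i => hsep j k i hk hK (Ioo_subset_Ioc_self hm)
      exact ⟨hs.state_impulse_eq hh hk hK hm.1 hm.2.le (hm.2.le.trans hle) hsepk,
        hs.state_eq_after_impulse hh hm.1 hm.2.le le_rfl hle hsepk⟩
end
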